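/- Let 1 < k < n−1 and let C be a maximal clique of Δ_k(V) that is not a maximal star. Then C = S^c(X) for some degenerate (k−1)-dimensional subspace X of F^n if and only if there exists a non-degenerate (k−1)-dimensional subspace X' of F^n such that the intersection C ∩ S(X') contains exactly one element. -/

import Mathlib

open Module

section Defs

variable (F : Type*) [Field F]

/-- The `i`-th coordinate hyperplane in `F^n`: the kernel of the `i`-th coordinate functional. -/
def coordHyp (n : ℕ) (i : Fin n) : Submodule F (Fin n → F) :=
  LinearMap.ker (LinearMap.proj (R := F) (φ := fun _ : Fin n => F) i)

/-- A subspace of `F^n` is degenerate if it is contained in some coordinate hyperplane. -/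
def IsDeg (n : ℕ) (W : Submodule F (Fin n → F)) : Prop :=
  ∃ i : Fin n, W ≤ coordHyp F n i

/-- A subspace of `F^n` is non-degenerate if it is not degenerate. -/
def IsNondeg (n : ℕ) (W : Submodule F (Fin n → F)) : Prop :=
  ¬ IsDeg F n W

/-- Adjacency of `k`-dimensional subspaces: distinct with `(k-1)`-dimensional intersection. -/
def AdjK (n k : ℕ) (A B : Submodule F (Fin n → F)) : Prop :=
  A ≠ B ∧ finrank F ↥(A ⊓ B) = k - 1

/-- The star `S(X)`: all `k`-dimensional subspaces containing `X`. -/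
def Sstar (n k : ℕ) (X : Submodule F (Fin n → F)) : Set (Submodule F (Fin n → F)) :=
  {A | finrank F ↥A = k ∧ X ≤ A}

/-- `S^c(X)`: all non-degenerate `k`-dimensional subspaces containing `X`. -/
def Sc (n k : ℕ) (X : Submodule F (Fin n → F)) : Set (Submodule F (Fin n → F)) :=
  {A | finrank F ↥A = k ∧ X ≤ A ∧ IsNondeg F n A}

/-- `T^c(Y)`: all non-degenerate `k`-dimensional subspaces contained in `Y`. -/
def Tc (n k : ℕ) (Y : Submodule F (Fin n → F)) : Set (Submodule F (Fin n → F)) :=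
  {A | finrank F ↥A = k ∧ A ≤ Y ∧ IsNondeg F n A}

/-- A clique of `Δ_k(V)`: a set of non-degenerate `k`-dimensional subspaces which are
pairwise adjacent. -/
def IsCliqueD (n k : ℕ) (C : Set (Submodule F (Fin n → F))) : Prop :=
  (∀ A ∈ C, finrank F ↥A = k ∧ IsNondeg F n A) ∧
    ∀ A ∈ C, ∀ B ∈ C, A ≠ B → AdjK F n k A B

/-- A maximal clique of `Δ_k(V)`. -/
def IsMaxCliqueD (n k : ℕ) (C : Set (Submodule F (Fin n → F))) : Prop :=
  IsCliqueD F n k C ∧ ∀ D, IsCliqueD F n k D → C ⊆ D → D = C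

/-- A star of `Δ_k(V)`: a set `S^c(X)` which is a maximal clique of `Δ_k(V)`. -/
def IsStarD (n k : ℕ) (S : Set (Submodule F (Fin n → F))) : Prop :=
  (∃ X : Submodule F (Fin n → F), finrank F ↥X = k - 1 ∧ S = Sc F n k X) ∧
    IsMaxCliqueD F n k S

/-- A top of `Δ_k(V)`: a set `T^c(Y)` which is a maximal clique of `Δ_k(V)`. -/
def IsTopD (n k : ℕ) (T : Set (Submodule F (Fin n → F))) : Prop :=
  (∃ Y : Submodule F (Fin n → F), finrank F ↥Y = k + 1 ∧ T = Tc F n k Y) ∧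
    IsMaxCliqueD F n k T

/-- Adjacency of maximal cliques used in the graphs `Δ_s` and `Δ_t`:
two distinct cliques such that every vertex of each is adjacent to some vertex of the other. -/
def AdjMC (n k : ℕ) (C1 C2 : Set (Submodule F (Fin n → F))) : Prop :=
  C1 ≠ C2 ∧ (∀ A ∈ C1, ∃ B ∈ C2, AdjK F n k A B) ∧
    (∀ A ∈ C2, ∃ B ∈ C1, AdjK F n k A B)

/-- Adjacency in the graphs `Δ'_s` and `Δ'_t`: adjacent as above with empty intersection. -/
def AdjMC' (n k : ℕ) (C1 C2 : Set (Submodule F (Fin n → F))) : Prop :=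
  AdjMC F n k C1 C2 ∧ C1 ∩ C2 = ∅

/-- A clique of the graph `Δ_s` (whose vertices are the stars of `Δ_k(V)`). -/
def IsCliqueDs (n k : ℕ) (𝔖 : Set (Set (Submodule F (Fin n → F)))) : Prop :=
  (∀ S ∈ 𝔖, IsStarD F n k S) ∧ ∀ S ∈ 𝔖, ∀ S' ∈ 𝔖, S ≠ S' → AdjMC F n k S S'

/-- A maximal clique of `Δ_s`. -/
def IsMaxCliqueDs (n k : ℕ) (𝔖 : Set (Set (Submodule F (Fin n → F)))) : Prop :=
  IsCliqueDs F n k 𝔖 ∧ ∀ 𝔖', IsCliqueDs F n k 𝔖' → 𝔖 ⊆ 𝔖' → 𝔖' = 𝔖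

/-- A clique of the graph `Δ'_s`. -/
def IsCliqueDs' (n k : ℕ) (𝔖 : Set (Set (Submodule F (Fin n → F)))) : Prop :=
  (∀ S ∈ 𝔖, IsStarD F n k S) ∧ ∀ S ∈ 𝔖, ∀ S' ∈ 𝔖, S ≠ S' → AdjMC' F n k S S'

/-- A maximal clique of `Δ'_s`. -/
def IsMaxCliqueDs' (n k : ℕ) (𝔖 : Set (Set (Submodule F (Fin n → F)))) : Prop :=
  IsCliqueDs' F n k 𝔖 ∧ ∀ 𝔖', IsCliqueDs' F n k 𝔖' → 𝔖 ⊆ 𝔖' → 𝔖' = 𝔖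

/-- A special set of stars: a maximal clique in both `Δ_s` and `Δ'_s`. -/
def IsSpecialStars (n k : ℕ) (𝔖 : Set (Set (Submodule F (Fin n → F)))) : Prop :=
  IsMaxCliqueDs F n k 𝔖 ∧ IsMaxCliqueDs' F n k 𝔖

/-- A clique of the graph `Δ_t` (whose vertices are the tops of `Δ_k(V)`). -/
def IsCliqueDt (n k : ℕ) (𝔗 : Set (Set (Submodule F (Fin n → F)))) : Prop :=
  (∀ T ∈ 𝔗, IsTopD F n k T) ∧ ∀ T ∈ 𝔗, ∀ T' ∈ 𝔗, T ≠ T' → AdjMC F n k T T'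

/-- A maximal clique of `Δ_t`. -/
def IsMaxCliqueDt (n k : ℕ) (𝔗 : Set (Set (Submodule F (Fin n → F)))) : Prop :=
  IsCliqueDt F n k 𝔗 ∧ ∀ 𝔗', IsCliqueDt F n k 𝔗' → 𝔗 ⊆ 𝔗' → 𝔗' = 𝔗

/-- A clique of the graph `Δ'_t`. -/
def IsCliqueDt' (n k : ℕ) (𝔗 : Set (Set (Submodule F (Fin n → F)))) : Prop :=
  (∀ T ∈ 𝔗, IsTopD F n k T) ∧ ∀ T ∈ 𝔗, ∀ T' ∈ 𝔗, T ≠ T' → AdjMC' F n k T T'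

/-- A maximal clique of `Δ'_t`. -/
def IsMaxCliqueDt' (n k : ℕ) (𝔗 : Set (Set (Submodule F (Fin n → F)))) : Prop :=
  IsCliqueDt' F n k 𝔗 ∧ ∀ 𝔗', IsCliqueDt' F n k 𝔗' → 𝔗 ⊆ 𝔗' → 𝔗' = 𝔗

/-- A special set of tops: a maximal clique in both `Δ_t` and `Δ'_t`. -/
def IsSpecialTops (n k : ℕ) (𝔗 : Set (Set (Submodule F (Fin n → F)))) : Prop :=
  IsMaxCliqueDt F n k 𝔗 ∧ IsMaxCliqueDt' F n k 𝔗

/-- `𝔗_X`: the set of all `T^c(Y)` over non-degenerate `(k+1)`-dimensional `Y` containing `X`. -/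
def TopsThrough (n k : ℕ) (X : Submodule F (Fin n → F)) :
    Set (Set (Submodule F (Fin n → F))) :=
  {T | ∃ Y : Submodule F (Fin n → F),
    finrank F ↥Y = k + 1 ∧ IsNondeg F n Y ∧ X ≤ Y ∧ T = Tc F n k Y}

end Defs

open Submodule in
theorem exists_finrank_eq_between {K V : Type*} [Field K] [AddCommGroup V] [Module K V]
    [Module.Finite K V] {P Q : Submodule K V} (hPQ : P ≤ Q) {m : ℕ} (hPm : finrank K P ≤ m)
    (hmQ : m ≤ finrank K Q) : ∃ R : Submodule K V, P ≤ R ∧ R ≤ Q ∧ finrank K R = m := by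
  induction m, hPm using Nat.le_induction with
  | base => exact ⟨P, le_rfl, hPQ, rfl⟩
  | succ m _ ih =>
    obtain ⟨R, hPR, hRQ, hR⟩ := ih (by omega)
    have hQR : ¬ Q ≤ R := fun h => by
      have := finrank_mono h
      omega
    obtain ⟨v, hvQ, hvR⟩ := SetLike.not_le_iff_exists.1 hQR
    refine ⟨R ⊔ K ∙ v, hPR.trans le_sup_left,
      sup_le hRQ ((span_singleton_le_iff_mem v Q).2 hvQ), ?_⟩
    rw [finrank_sup_span_singleton hvR, hR]

section NondegenerateSubspaces

variable {F : Type*} [Field F] {n k : ℕ}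

open Submodule

theorem IsNondeg.mono {A B : Submodule F (Fin n → F)} (hA : IsNondeg F n A) (h : A ≤ B) :
    IsNondeg F n B :=
  fun ⟨i, hi⟩ => hA ⟨i, h.trans hi⟩

theorem isNondeg_of_one_mem {A : Submodule F (Fin n → F)} (h : (1 : Fin n → F) ∈ A) :
    IsNondeg F n A := by
  rintro ⟨i, hi⟩
  simpa [coordHyp] using hi h

theorem Sc_eq_Sstar {X : Submodule F (Fin n → F)} (hX : IsNondeg F n X) :
    Sc F n k X = Sstar F n k X := by
  ext A
  exact ⟨fun h => ⟨h.1, h.2.1⟩, fun h => ⟨h.1, h.2, hX.mono h.2⟩⟩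

theorem AdjK.finrank_sup {A B : Submodule F (Fin n → F)} (h : AdjK F n k A B) (hk : 0 < k)
    (hA : finrank F A = k) (hB : finrank F B = k) : finrank F ↥(A ⊔ B) = k + 1 := by
  have := finrank_sup_add_finrank_inf_eq A B
  have := h.2
  omega

theorem finrank_inf_lt_of_ne {A B : Submodule F (Fin n → F)} (hA : finrank F A = k)
    (hB : finrank F B = k) (hAB : A ≠ B) : finrank F ↥(A ⊓ B) < k := by
  by_contra! h
  have h₁ : A ⊓ B = A := eq_of_le_of_finrank_le inf_le_left (by omega)
  exact hAB (eq_of_le_of_finrank_eq (inf_eq_left.1 h₁) (hA.trans hB.symm))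

/-- If three pairwise adjacent subspaces do not form part of a star, they form part of a top. -/
theorem AdjK.le_sup {A B D : Submodule F (Fin n → F)} (hAB : AdjK F n k A B)
    (hDA : AdjK F n k D A) (hDB : AdjK F n k D B) (hD : finrank F D = k)
    (h : ¬ A ⊓ B ≤ D) : D ≤ A ⊔ B := by
  have hle : D ⊓ A ⊔ D ⊓ B ≤ D := sup_le inf_le_left inf_le_left
  rcases eq_or_lt_of_le hle with heq | hlt
  · rw [← heq]
    exact sup_le_sup inf_le_right inf_le_right
  · have hr := finrank_lt_finrank_of_lt hlt
    have h₁ : D ⊓ A = D ⊓ A ⊔ D ⊓ B :=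
      eq_of_le_of_finrank_le le_sup_left (by rw [hDA.2]; omega)
    have h₂ : D ⊓ B ≤ D ⊓ A := h₁ ▸ le_sup_right
    have h₃ : D ⊓ B = A ⊓ B :=
      eq_of_le_of_finrank_eq (le_inf (h₂.trans inf_le_right) inf_le_right)
        (hDB.2.trans hAB.2.symm)
    exact absurd (h₃ ▸ inf_le_left) h

theorem isCliqueD_Sc {X : Submodule F (Fin n → F)} (hX : finrank F X = k - 1) :
    IsCliqueD F n k (Sc F n k X) := by
  refine ⟨fun A hA => ⟨hA.1, hA.2.2⟩, fun A hA B hB hAB => ⟨hAB, ?_⟩⟩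
  have := finrank_inf_lt_of_ne hA.1 hB.1 hAB
  have := finrank_mono (le_inf hA.2.1 hB.2.1)
  omega

theorem isCliqueD_Tc {Y : Submodule F (Fin n → F)} (hY : finrank F Y = k + 1) :
    IsCliqueD F n k (Tc F n k Y) := by
  refine ⟨fun A hA => ⟨hA.1, hA.2.2⟩, fun A hA B hB hAB => ⟨hAB, ?_⟩⟩
  have := finrank_inf_lt_of_ne hA.1 hB.1 hAB
  have := finrank_mono (sup_le hA.2.1 hB.2.1)
  have := finrank_sup_add_finrank_inf_eq A B
  have := hA.1
  have := hB.1
  omega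

/-- A clique with two distinct members is contained in a star or in a top. -/
theorem IsCliqueD.subset_Sc_or_subset_Tc {C : Set (Submodule F (Fin n → F))}
    (hC : IsCliqueD F n k C) (hk : 0 < k) (hC₂ : C.Nontrivial) :
    (∃ X : Submodule F (Fin n → F), finrank F X = k - 1 ∧ C ⊆ Sc F n k X) ∨
      ∃ Y : Submodule F (Fin n → F), finrank F Y = k + 1 ∧ C ⊆ Tc F n k Y := by
  obtain ⟨A, hA, B, hB, hne⟩ := hC₂
  have hAB := hC.2 A hA B hB hne
  have hA' := hC.1 A hA
  have hB' := hC.1 B hB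
  by_cases hstar : ∀ D ∈ C, A ⊓ B ≤ D
  · exact .inl ⟨A ⊓ B, hAB.2, fun D hD => ⟨(hC.1 D hD).1, hstar D hD, (hC.1 D hD).2⟩⟩
  push Not at hstar
  obtain ⟨D, hD, hXD⟩ := hstar
  have hD' := hC.1 D hD
  have hDA := hC.2 D hD A hA (by rintro rfl; exact hXD inf_le_left)
  have hDB := hC.2 D hD B hB (by rintro rfl; exact hXD inf_le_right)
  have hDY := hAB.le_sup hDA hDB hD'.1 hXD
  refine .inr ⟨A ⊔ B, hAB.finrank_sup hk hA'.1 hB'.1,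
    fun E hE => ⟨(hC.1 E hE).1, ?_, (hC.1 E hE).2⟩⟩
  rcases eq_or_ne E A with rfl | hEA
  · exact le_sup_left
  rcases eq_or_ne E B with rfl | hEB
  · exact le_sup_right
  rcases eq_or_ne E D with rfl | hED
  · exact hDY
  have hadjA := hC.2 E hE A hA hEA
  by_cases h₁ : A ⊓ B ≤ E
  · by_cases h₂ : D ⊓ A ≤ E
    · have hXA : D ⊓ A = A ⊓ E :=
        eq_of_le_of_finrank_eq (le_inf inf_le_right h₂)
          (by rw [hDA.2, inf_comm, hadjA.2])
      have hXB : A ⊓ B = A ⊓ E :=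
        eq_of_le_of_finrank_eq (le_inf inf_le_left h₁)
          (by rw [hAB.2, inf_comm, hadjA.2])
      exact absurd ((hXB.trans hXA.symm).le.trans inf_le_left) hXD
    · exact (hDA.le_sup (hC.2 E hE D hD hED) hadjA (hC.1 E hE).1 h₂).trans
        (sup_le hDY le_sup_left)
  · exact hAB.le_sup hadjA (hC.2 E hE B hB hEB) (hC.1 E hE).1 h₁

/-- A `(k - 1)`-dimensional subspace of a member of a top lies in a second `k`-dimensional
subspace of that top. -/
theorem exists_ne_mem_Tc {X A Y : Submodule F (Fin n → F)} (hk : 0 < k)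
    (hX : finrank F X = k - 1) (hXn : IsNondeg F n X) (hA : finrank F A = k)
    (hY : finrank F Y = k + 1) (hXA : X ≤ A) (hAY : A ≤ Y) :
    ∃ B ∈ Tc F n k Y, X ≤ B ∧ B ≠ A := by
  have hYA : ¬ Y ≤ A := fun h => by
    have := finrank_mono h
    omega
  obtain ⟨v, hvY, hvA⟩ := SetLike.not_le_iff_exists.1 hYA
  refine ⟨X ⊔ F ∙ v, ⟨?_, sup_le (hXA.trans hAY) ((span_singleton_le_iff_mem v Y).2 hvY),
    hXn.mono le_sup_left⟩, le_sup_left, ?_⟩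
  · rw [finrank_sup_span_singleton fun h => hvA (hXA h)]
    omega
  · rintro rfl
    exact hvA (mem_sup_right (mem_span_singleton_self v))

end NondegenerateSubspaces

/-- a maximal clique of `Δ_k(V)` which is not a maximal star is a
non-maximal star `S^c(X)` (with `X` degenerate) iff some maximal star intersects it in
exactly one element. -/
theorem stmt7 (F : Type*) [Field F] (n k : ℕ)
    (hk1 : 1 < k) (hk2 : k < n - 1)
    (C : Set (Submodule F (Fin n → F))) (hC : IsMaxCliqueD F n k C)
    (hns : ¬ ∃ X : Submodule F (Fin n → F),
        finrank F ↥X = k - 1 ∧ IsNondeg F n X ∧ C = Sstar F n k X) :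
    (∃ X : Submodule F (Fin n → F),
        finrank F ↥X = k - 1 ∧ IsDeg F n X ∧ C = Sc F n k X) ↔
      ∃ X' : Submodule F (Fin n → F), finrank F ↥X' = k - 1 ∧ IsNondeg F n X' ∧
        ∃ A : Submodule F (Fin n → F), C ∩ Sstar F n k X' = {A} := by
  constructor
  · rintro ⟨X, hX, hXd, rfl⟩
    have hone : (1 : Fin n → F) ∉ X := fun h => isNondeg_of_one_mem h hXd
    have hdim := Submodule.finrank_sup_span_singleton hone
    set A := X ⊔ Submodule.span F {(1 : Fin n → F)}
    have hdimA : finrank F A = k := by omega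
    have honeA : (1 : Fin n → F) ∈ A :=
      Submodule.mem_sup_right (Submodule.mem_span_singleton_self _)
    obtain ⟨X', hX'one, hX'A, hX'⟩ :=
      exists_finrank_eq_between (P := Submodule.span F {(1 : Fin n → F)}) (Q := A) (m := k - 1)
        le_sup_right ((finrank_span_singleton (K := F) (by rintro h; simp [h] at hone)).trans_le
          (by omega)) (by omega)
    have hone' : (1 : Fin n → F) ∈ X' := (Submodule.span_singleton_le_iff_mem _ _).1 hX'one
    refine ⟨X', hX', isNondeg_of_one_mem hone', A, ?_⟩
    ext B
    constructor
    · rintro ⟨⟨hB, hXB, -⟩, -, hX'B⟩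
      exact (Submodule.eq_of_le_of_finrank_eq (sup_le hXB (hX'one.trans hX'B))
        (hdimA.trans hB.symm)).symm
    · rintro rfl
      exact ⟨⟨hdimA, le_sup_left, isNondeg_of_one_mem honeA⟩, hdimA, hX'A⟩
  · rintro ⟨X', hX', hX'n, A, hCA⟩
    have hk : 0 < k := by omega
    obtain ⟨hAC, hA, hX'A⟩ : A ∈ C ∩ Sstar F n k X' := hCA ▸ rfl
    have hstar : ∀ X : Submodule F (Fin n → F), finrank F X = k - 1 → C ⊆ Sc F n k X →
        IsDeg F n X ∧ C = Sc F n k X := fun X hX hCX => by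
      have hCX' := (hC.2 _ (isCliqueD_Sc hX) hCX).symm
      exact ⟨by_contra fun h => hns ⟨X, hX, h, hCX'.trans (Sc_eq_Sstar h)⟩, hCX'⟩
    rcases C.subsingleton_or_nontrivial with hsub | hnt
    · exact ⟨X', hX', hstar X' hX' fun B hB => hsub hAC hB ▸ ⟨hA, hX'A, hX'n.mono hX'A⟩⟩
    rcases hC.1.subset_Sc_or_subset_Tc hk hnt with ⟨X, hX, hCX⟩ | ⟨Y, hY, hCY⟩
    · exact ⟨X, hX, hstar X hX hCX⟩
    · obtain ⟨B, hB, hX'B, hBA⟩ := exists_ne_mem_Tc hk hX' hX'n hA hY hX'A (hCY hAC).2.1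
      have hBC : B ∈ C := hC.2 _ (isCliqueD_Tc hY) hCY ▸ hB
      have hmem : B ∈ C ∩ Sstar F n k X' := ⟨hBC, hB.1, hX'B⟩
      rw [hCA] at hmem
      exact absurd hmem hBA
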